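/- Let d be a natural number. The set of all asymptotic ranks of d-way complex tensors, i.e. the set of real numbers of the form lim_{m → ∞} (R(T^{⊠m}))^{1/m} where T ranges over all d-way complex tensors and R denotes tensor rank, is countable. -/

import Mathlib

/-- The vertical tensor product of two `d`-way complex tensors. -/
def vtp {d : ℕ} {n n' : Fin d → ℕ} (T : ((i : Fin d) → Fin (n i)) → ℂ)
    (S : ((i : Fin d) → Fin (n' i)) → ℂ) :
    ((i : Fin d) → Fin (n i * n' i)) → ℂ :=
  fun j => T (fun i => (finProdFinEquiv.symm (j i)).1) *
    S (fun i => (finProdFinEquiv.symm (j i)).2)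

/-- The format of the `m`-th vertical tensor power of a tensor of format `n`. -/
def vpowFormat {d : ℕ} (n : Fin d → ℕ) : ℕ → Fin d → ℕ
  | 0 => fun _ => 1
  | m + 1 => fun i => n i * vpowFormat n m i

/-- The `m`-th vertical tensor power of a `d`-way complex tensor. -/
def vpow {d : ℕ} {n : Fin d → ℕ} (T : ((i : Fin d) → Fin (n i)) → ℂ) :
    (m : ℕ) → ((i : Fin d) → Fin (vpowFormat n m i)) → ℂ
  | 0 => fun _ => 1
  | m + 1 => vtp T (vpow T m)

/-- The rank of a `d`-way complex tensor of format `n`: the smallest `r` such that `T`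
is a sum of `r` tensors of the form `v_1 ⊗ ⋯ ⊗ v_d`. -/
noncomputable def tensorRank {d : ℕ} {n : Fin d → ℕ}
    (T : ((i : Fin d) → Fin (n i)) → ℂ) : ℕ :=
  sInf {r : ℕ | ∃ v : Fin r → (i : Fin d) → Fin (n i) → ℂ,
    T = fun α => ∑ j : Fin r, ∏ i : Fin d, v j i (α i)}

open Cardinal in
/-- Uncountable algebraically closed extensions of equal cardinality of a countable ring
embed into each other over that ring. -/
theorem exists_ringHom_comp_eq_of_isAlgClosed {R K L : Type} [CommRing R] [Countable R]
    [Field K] [Field L] [IsAlgClosed K] [IsAlgClosed L] {g : R →+* K} {h : R →+* L}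
    (hg : Function.Injective g) (hh : Function.Injective h) (hK : ℵ₀ < #K) (hKL : #K = #L) :
    ∃ f : K →+* L, f.comp g = h := by
  let _ : Algebra R K := g.toAlgebra
  let _ : Algebra R L := h.toAlgebra
  have : FaithfulSMul R K := (faithfulSMul_iff_algebraMap_injective R K).2 hg
  have : FaithfulSMul R L := (faithfulSMul_iff_algebraMap_injective R L).2 hh
  have : Nontrivial R := RingHom.domain_nontrivial (algebraMap R K)
  obtain ⟨s, hs⟩ := exists_isTranscendenceBasis R K
  obtain ⟨t, ht⟩ := exists_isTranscendenceBasis R L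
  have hst : #s = #t := by
    rw [← IsAlgClosed.cardinal_eq_cardinal_transcendence_basis_of_aleph0_lt' _ hs
        mk_le_aleph0 hK,
      ← IsAlgClosed.cardinal_eq_cardinal_transcendence_basis_of_aleph0_lt' _ ht
        mk_le_aleph0 (hKL ▸ hK), hKL]
  obtain ⟨e⟩ := Cardinal.eq.1 hst
  let i := Algebra.adjoin R (Set.range ((↑) : s → K))
  have : IsAlgClosure i K := IsAlgClosed.isAlgClosure_of_transcendence_basis _ hs
  have : Algebra.IsAlgebraic i K := hs.isAlgebraic
  let f : i →ₐ[R] L := (MvPolynomial.aeval fun x => (e x : L)).comp hs.1.aevalEquiv.symm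
  have hf : Function.Injective f := by
    have h : AlgebraicIndependent R fun x => (e x : L) := ht.1.comp e e.injective
    exact Function.Injective.comp (g := MvPolynomial.aeval fun x => (e x : L)) h
      hs.1.aevalEquiv.symm.injective
  let _ : Algebra i L := f.toRingHom.toAlgebra
  have : FaithfulSMul i L := (faithfulSMul_iff_algebraMap_injective i L).2 hf
  have : IsScalarTower R i L := IsScalarTower.of_algebraMap_eq fun r => (f.commutes r).symm
  exact ⟨_, ((IsAlgClosed.lift : K →ₐ[i] L).restrictScalars R).comp_algebraMap⟩

theorem MvPolynomial.countable_of_countable (ι R : Type*) [Countable ι] [CommSemiring R]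
    [Countable R] : Countable (MvPolynomial ι R) := by
  rw [← Cardinal.mk_le_aleph0_iff]
  exact MvPolynomial.cardinalMk_le_max_lift.trans (by simp)

/-- Two families of complex numbers satisfying the same integral polynomial relations
are related by an endomorphism of `ℂ`. -/
theorem exists_ringHom_of_ker_aeval_eq {ι : Type} [Countable ι] {a b : ι → ℂ}
    (h : RingHom.ker (MvPolynomial.aeval (R := ℤ) a) =
      RingHom.ker (MvPolynomial.aeval (R := ℤ) b)) :
    ∃ f : ℂ →+* ℂ, ∀ x, f (a x) = b x := by
  let I := RingHom.ker (MvPolynomial.aeval (R := ℤ) a)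
  let fa : MvPolynomial ι ℤ ⧸ I →+* ℂ :=
    Ideal.Quotient.lift I (MvPolynomial.aeval (R := ℤ) a).toRingHom fun _ hp => hp
  let fb : MvPolynomial ι ℤ ⧸ I →+* ℂ :=
    Ideal.Quotient.lift I (MvPolynomial.aeval (R := ℤ) b).toRingHom fun _ hp => h.le hp
  have hfa : Function.Injective fa :=
    RingHom.lift_injective_of_ker_le_ideal _ (fun _ hp => hp) le_rfl
  have hfb : Function.Injective fb :=
    RingHom.lift_injective_of_ker_le_ideal _ (fun _ hp => h.le hp) h.ge
  have : Countable (MvPolynomial ι ℤ) := MvPolynomial.countable_of_countable ι ℤ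
  have : Countable (MvPolynomial ι ℤ ⧸ I) := Ideal.Quotient.mk_surjective.countable
  obtain ⟨f, hf⟩ := exists_ringHom_comp_eq_of_isAlgClosed hfa hfb
    (by rw [Cardinal.mk_complex]; exact Cardinal.aleph0_lt_continuum) rfl
  exact ⟨f, fun x => by
    simpa [fa, fb] using RingHom.congr_fun hf (Ideal.Quotient.mk I (MvPolynomial.X x))⟩

/-- A countable Noetherian ring has only countably many ideals. -/
theorem Ideal.countable_of_isNoetherianRing (R : Type*) [CommRing R] [IsNoetherianRing R]
    [Countable R] : Countable (Ideal R) := by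
  have : Function.Surjective fun s : Finset R => Ideal.span (s : Set R) := fun I =>
    (isNoetherianRing_iff_ideal_fg R).1 inferInstance I
  exact this.countable

theorem vpow_map {d : ℕ} {n : Fin d → ℕ} (f : ℂ →+* ℂ) (T : ((i : Fin d) → Fin (n i)) → ℂ)
    (m : ℕ) : vpow (fun α => f (T α)) m = fun α => f (vpow T m α) := by
  induction m with
  | zero => funext α; simp [vpow]
  | succ m ih => funext α; simp [vpow, vtp, ih]

theorem exists_rank_decomposition_map {d : ℕ} {n : Fin d → ℕ} (f : ℂ →+* ℂ)
    {T : ((i : Fin d) → Fin (n i)) → ℂ} {r : ℕ}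
    (h : ∃ v : Fin r → (i : Fin d) → Fin (n i) → ℂ,
      T = fun α => ∑ j : Fin r, ∏ i : Fin d, v j i (α i)) :
    ∃ v : Fin r → (i : Fin d) → Fin (n i) → ℂ,
      (fun α => f (T α)) = fun α => ∑ j : Fin r, ∏ i : Fin d, v j i (α i) := by
  obtain ⟨v, rfl⟩ := h
  exact ⟨fun j i a => f (v j i a), by simp [map_sum, map_prod]⟩

/-- Tensors satisfying the same integral polynomial relations have the same rank
in every vertical power. -/
theorem tensorRank_vpow_eq_of_ker_aeval_eq {d : ℕ} {n : Fin d → ℕ}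
    {T S : ((i : Fin d) → Fin (n i)) → ℂ}
    (h : RingHom.ker (MvPolynomial.aeval (R := ℤ) T) =
      RingHom.ker (MvPolynomial.aeval (R := ℤ) S)) (m : ℕ) :
    tensorRank (vpow T m) = tensorRank (vpow S m) := by
  obtain ⟨f, hf⟩ := exists_ringHom_of_ker_aeval_eq h
  obtain ⟨g, hg⟩ := exists_ringHom_of_ker_aeval_eq h.symm
  have hS : vpow S m = fun α => f (vpow T m α) := by rw [← vpow_map]; simp only [hf]
  have hT : vpow T m = fun α => g (vpow S m α) := by rw [← vpow_map]; simp only [hg]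
  unfold tensorRank
  congr 1
  ext r
  refine ⟨fun hr => ?_, fun hr => ?_⟩
  · rw [hS]; exact exists_rank_decomposition_map f hr
  · rw [hT]; exact exists_rank_decomposition_map g hr

/-- the set of asymptotic ranks of `d`-way complex tensors is
countable. -/
theorem countable_asymptotic_ranks (d : ℕ) :
    {x : ℝ | ∃ (n : Fin d → ℕ) (T : ((i : Fin d) → Fin (n i)) → ℂ),
      Filter.Tendsto (fun m : ℕ => ((tensorRank (vpow T m) : ℝ)) ^ (1 / (m : ℝ)))
        Filter.atTop (nhds x)}.Countable := by
  simp only [Set.ofPred_exists]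
  refine Set.countable_iUnion fun n => ?_
  have : Countable (MvPolynomial ((i : Fin d) → Fin (n i)) ℤ) :=
    MvPolynomial.countable_of_countable _ _
  have : Countable (Ideal (MvPolynomial ((i : Fin d) → Fin (n i)) ℤ)) :=
    Ideal.countable_of_isNoetherianRing _
  let u (T : ((i : Fin d) → Fin (n i)) → ℂ) (m : ℕ) : ℝ :=
    (tensorRank (vpow T m) : ℝ) ^ (1 / (m : ℝ))
  refine (Set.countable_iUnion fun I : Ideal (MvPolynomial ((i : Fin d) → Fin (n i)) ℤ) =>
    Set.Subsingleton.countable (s := {x : ℝ | ∃ T : ((i : Fin d) → Fin (n i)) → ℂ,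
      RingHom.ker (MvPolynomial.aeval (R := ℤ) T) = I ∧
        Filter.Tendsto (u T) Filter.atTop (nhds x)}) ?_).mono ?_
  · rintro x ⟨T, hT, hx⟩ y ⟨S, hS, hy⟩
    have : u T = u S := funext fun m => by
      simp only [u, tensorRank_vpow_eq_of_ker_aeval_eq (hT.trans hS.symm)]
    exact tendsto_nhds_unique hx (this ▸ hy)
  · exact Set.iUnion_subset fun T x hx => Set.mem_iUnion.2 ⟨_, T, rfl, hx⟩
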